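/- arXiv:1902.01490 — 4 statements merged into one kernel-verified Lean document; each statement's English description precedes it below -/
import Mathlib

section
/- If K is a field, then the universal Novikov field Λ over K, with pointwise addition and convolution multiplication, is a field: every nonzero element has a multiplicative inverse. -/
/-- The carrier of the universal Novikov field `Λ` over `K`: functions `f : ℝ → K` such
that for every `C` only finitely many exponents `a ≤ C` carry a nonzero coefficient. -/
abbrev NovikovField (K : Type*) [Field K] : Type _ :=
  {f : ℝ → K // ∀ C : ℝ, {a : ℝ | a ≤ C ∧ f a ≠ 0}.Finite}

namespace HahnSeries

/-- A Hahn series has left-finite support if only finitely many exponents below any given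
bound carry a nonzero coefficient. -/
def LeftFinite {R : Type*} [Zero R] (x : HahnSeries ℝ R) : Prop :=
  ∀ C : ℝ, {a : ℝ | a ≤ C ∧ x.coeff a ≠ 0}.Finite

theorem LeftFinite.add {R : Type*} [AddMonoid R] {x y : HahnSeries ℝ R}
    (hx : x.LeftFinite) (hy : y.LeftFinite) : (x + y).LeftFinite := by
  intro C
  refine ((hx C).union (hy C)).subset ?_
  rintro a ⟨ha, h⟩
  by_cases h1 : x.coeff a = 0
  · exact Or.inr ⟨ha, fun h2 => h (by simp [h1, h2])⟩
  · exact Or.inl ⟨ha, h1⟩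

theorem leftFinite_single {R : Type*} [Zero R] (b : ℝ) (r : R) :
    (single b r).LeftFinite := by
  intro C
  refine (Set.finite_singleton b).subset ?_
  rintro a ⟨-, h⟩
  by_contra hne
  exact h (coeff_single_of_ne hne)

theorem LeftFinite.mul {R : Type*} [NonUnitalNonAssocSemiring R] {x y : HahnSeries ℝ R}
    (hx : x.LeftFinite) (hy : y.LeftFinite) : (x * y).LeftFinite := by
  intro C
  refine (((hx (C - y.order)).image2 (· + ·) (hy (C - x.order)))).subset ?_
  rintro a ⟨ha, h⟩
  rw [coeff_mul] at h
  obtain ⟨⟨i, j⟩, hij, -⟩ := Finset.exists_ne_zero_of_sum_ne_zero h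
  rw [Finset.mem_antidiagonal] at hij
  obtain ⟨hi, hj, hadd⟩ := hij
  have h1 := order_le_of_coeff_ne_zero hi
  have h2 := order_le_of_coeff_ne_zero hj
  dsimp only at hadd h1 h2
  exact ⟨i, ⟨by linarith, hi⟩, j, ⟨by linarith, hj⟩, hadd⟩

/-- Below the next exponent after the order, the support of a left-finite series has a gap. -/
theorem LeftFinite.exists_gap {R : Type*} [Zero R] {x : HahnSeries ℝ R}
    (hx : x.LeftFinite) (a : ℝ) :
    ∃ ε > 0, ∀ b, a < b → x.coeff b ≠ 0 → a + ε ≤ b := by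
  have hfin : (insert (a + 1) {b | (b ≤ a + 1 ∧ x.coeff b ≠ 0) ∧ a < b}).Finite :=
    ((hx (a + 1)).subset fun b hb => hb.1).insert _
  obtain ⟨m, hm, hmin⟩ := Set.exists_min_image _ id hfin (Set.insert_nonempty _ _)
  refine ⟨m - a, ?_, fun b hab hb => ?_⟩
  · rcases hm with rfl | hm
    · simp
    · exact sub_pos.2 hm.2
  · rw [add_sub_cancel]
    rcases le_total b (a + 1) with h | h
    · exact hmin b (Or.inr ⟨⟨h, hb⟩, hab⟩)
    · exact (hmin (a + 1) (Or.inl rfl)).trans h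

theorem LeftFinite.of_mul_eq_one {R : Type*} [Semiring R] [NoZeroDivisors R]
    {x y : HahnSeries ℝ R} (hx : x.LeftFinite) (hxy : x * y = 1) : y.LeftFinite := by
  rcases eq_or_ne x 0 with rfl | hx0
  · rw [zero_mul] at hxy
    rw [← mul_one y, ← hxy, mul_zero]
    simpa using leftFinite_single (0 : ℝ) (0 : R)
  obtain ⟨ε, hε, hgap⟩ := hx.exists_gap x.order
  have key : ∀ n : ℕ, {d : ℝ | d ≤ y.order - ε + n * ε ∧ y.coeff d ≠ 0}.Finite := by
    intro n
    induction n with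
    | zero =>
      refine Set.finite_empty.subset ?_
      rintro d ⟨hd, h⟩
      have := order_le_of_coeff_ne_zero h
      simp only [Nat.cast_zero, zero_mul] at hd
      exact absurd this (by linarith)
    | succ n ih =>
      refine ((Set.Finite.image2 (fun b e => b + e - x.order)
        (hx (x.order + n * ε)) ih).insert (-x.order)).subset ?_
      rintro d ⟨hd, h⟩
      by_cases hd0 : d = -x.order
      · exact Or.inl hd0
      right
      have hc : (x * y).coeff (x.order + d) = 0 := by
        rw [hxy, coeff_one, if_neg]
        intro h0
        exact hd0 (by linarith)
      rw [coeff_mul] at hc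
      have hx1 : x.coeff x.order ≠ 0 := coeff_order_eq_zero.not.2 hx0
      by_contra hno
      refine mul_ne_zero hx1 h ?_
      rw [← hc]
      symm
      refine Finset.sum_eq_single (x.order, d) ?_ ?_
      · rintro ⟨b, e⟩ hbe hne
        rw [Finset.mem_antidiagonal] at hbe
        obtain ⟨hb, he, hadd⟩ := hbe
        dsimp only at hb he hadd
        have hb1 := order_le_of_coeff_ne_zero hb
        have he1 := order_le_of_coeff_ne_zero he
        have hlt : x.order < b := by
          refine lt_of_le_of_ne hb1 fun hEq => hne ?_
          rw [← hEq] at hadd ⊢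
          rw [add_left_cancel hadd]
        have hb2 := hgap b hlt hb
        push_cast at hd
        refine absurd ⟨b, ⟨?_, hb⟩, e, ⟨?_, he⟩, ?_⟩ hno
        · linarith
        · linarith
        · dsimp only
          linarith
      · intro hmem
        exact absurd (Finset.mem_antidiagonal.2 ⟨hx1, h, rfl⟩) hmem
  intro C
  obtain ⟨n, hn⟩ := exists_nat_gt ((C - y.order + ε) / ε)
  rw [div_lt_iff₀ hε] at hn
  exact (key n).subset fun d hd => ⟨by linarith [hd.1], hd.2⟩

theorem coeff_mul_eq_finsum {R : Type*} [NonUnitalNonAssocSemiring R]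
    (x y : HahnSeries ℝ R) (a : ℝ) :
    (x * y).coeff a = ∑ᶠ b : ℝ, x.coeff b * y.coeff (a - b) := by
  classical
  rw [coeff_mul, finsum_eq_sum_of_support_subset (s := (Finset.antidiagonal
    x.isPWO_support y.isPWO_support a).image Prod.fst), Finset.sum_image]
  · refine Finset.sum_congr rfl fun p hp => ?_
    rw [Finset.mem_antidiagonal] at hp
    rw [← hp.2.2, add_sub_cancel_left]
  · intro p hp q hq hpq
    rw [Finset.mem_coe, Finset.mem_antidiagonal] at hp hq
    refine Prod.ext hpq (add_left_cancel (a := p.1) ?_)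
    rw [hp.2.2, hpq, hq.2.2]
  · intro b hb
    rw [Finset.mem_coe, Finset.mem_image]
    exact ⟨(b, a - b), Finset.mem_antidiagonal.2
      ⟨left_ne_zero_of_mul hb, right_ne_zero_of_mul hb, add_sub_cancel b a⟩, rfl⟩

/-- The Hahn series with left-finite support form a subfield. -/
noncomputable def leftFiniteSubfield (K : Type*) [Field K] : Subfield (HahnSeries ℝ K) where
  carrier := {x | x.LeftFinite}
  zero_mem' := by simpa using leftFinite_single (0 : ℝ) (0 : K)
  one_mem' := leftFinite_single 0 1
  add_mem' := LeftFinite.add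
  mul_mem' := LeftFinite.mul
  neg_mem' := fun {x} hx C => by simpa using hx C
  inv_mem' := fun x hx => by
    rcases eq_or_ne x 0 with rfl | h
    · rwa [inv_zero]
    · exact LeftFinite.of_mul_eq_one hx (mul_inv_cancel₀ h)

end HahnSeries

theorem isPWO_support_of_leftFinite {R : Type*} [Zero R] {f : ℝ → R}
    (hf : ∀ C : ℝ, {a : ℝ | a ≤ C ∧ f a ≠ 0}.Finite) : (Function.support f).IsPWO := by
  rw [Set.isPWO_iff_isWF, Set.isWF_iff_no_descending_seq]
  intro u hu hmem
  refine Set.infinite_of_injective_forall_mem (s := {a | a ≤ u 0 ∧ f a ≠ 0}) hu.injective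
    (fun n => ⟨hu.antitone (Nat.zero_le n), hmem n⟩) (hf (u 0))

/-- Novikov series are the Hahn series with left-finite support. -/
noncomputable def novikovEquiv (K : Type*) [Field K] :
    NovikovField K ≃ HahnSeries.leftFiniteSubfield K where
  toFun f := ⟨⟨f.val, isPWO_support_of_leftFinite f.property⟩, f.property⟩
  invFun x := ⟨x.val.coeff, x.property⟩
  left_inv _ := rfl
  right_inv _ := rfl

/-- If `K` is a field then the universal Novikov field `Λ` over `K`, with pointwise
addition and convolution multiplication, is a field: in particular every nonzero element
has a multiplicative inverse. -/
theorem novikov_field_is_field (K : Type*) [Field K] :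
    ∃ fieldI : Field (NovikovField K),
      letI := fieldI
      (∀ f g : NovikovField K, ∀ a : ℝ, (f + g).val a = f.val a + g.val a) ∧
      (∀ f g : NovikovField K, ∀ a : ℝ,
        (f * g).val a = ∑ᶠ b : ℝ, f.val b * g.val (a - b)) ∧
      (∀ f : NovikovField K, f ≠ 0 → ∃ g : NovikovField K, f * g = 1) := by
  refine ⟨(novikovEquiv K).field, fun f g a => rfl, fun f g a => ?_, fun f hf => ?_⟩
  · exact HahnSeries.coeff_mul_eq_finsum (novikovEquiv K f).val (novikovEquiv K g).val a
  · let := (novikovEquiv K).field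
    exact ⟨f⁻¹, mul_inv_cancel₀ hf⟩
end

section
/- Let K be a commutative ring, σ any type, and A = K[X_x : x ∈ σ] the polynomial algebra on variables indexed by σ. Suppose D : A → A is a K-linear derivation satisfying D ∘ D = 0 and such that D(X_x) has vanishing constant term for every x ∈ σ. Let π_1 denote the projection of a polynomial onto its homogeneous component of degree 1, and let ∂_lin be the K-linear endomorphism of the module of homogeneous degree-1 polynomials determined by ∂_lin(X_x) = π_1(D(X_x)). Then ∂_lin ∘ ∂_lin = 0. -/
open MvPolynomial

namespace MvPolynomial

variable {K σ : Type*} [CommRing K]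

theorem homogeneousComponent_one_mul (p q : MvPolynomial σ K) (hq : constantCoeff q = 0) :
    homogeneousComponent 1 (p * q) = constantCoeff p • homogeneousComponent 1 q := by
  classical
  ext d
  rw [coeff_smul, coeff_homogeneousComponent, coeff_homogeneousComponent]
  split_ifs with hd
  · obtain ⟨i, rfl⟩ := (Finsupp.sum_eq_one_iff d).mp hd
    rw [constantCoeff_eq] at hq
    simp [coeff_mul, Finsupp.antidiagonal_single, Finset.Nat.antidiagonal_succ, hq,
      constantCoeff_eq]
  · simp

theorem constantCoeff_derivation_eq_zero
    (D : Derivation K (MvPolynomial σ K) (MvPolynomial σ K))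
    (hconst : ∀ x : σ, constantCoeff (D (X x)) = 0) (p : MvPolynomial σ K) :
    constantCoeff (D p) = 0 := by
  induction p using MvPolynomial.induction_on with
  | C a => simp
  | add p q hp hq => simp [hp, hq]
  | mul_X p i _ => simp [hconst]

/-- A derivation preserving the augmentation ideal induces `π₁ ∘ D` on linear parts. -/
theorem homogeneousComponent_one_derivation
    (D : Derivation K (MvPolynomial σ K) (MvPolynomial σ K))
    (hconst : ∀ x : σ, constantCoeff (D (X x)) = 0) (p : MvPolynomial σ K) :
    homogeneousComponent 1 (D (homogeneousComponent 1 p)) = homogeneousComponent 1 (D p) := by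
  induction p using MvPolynomial.induction_on with
  | C a => simp [homogeneousComponent_of_mem (isHomogeneous_C σ a)]
  | add p q hp hq => simp [hp, hq]
  | mul_X p i _ =>
    have hX : homogeneousComponent 1 (X i : MvPolynomial σ K) = X i := by
      simp [homogeneousComponent_of_mem (isHomogeneous_X K i)]
    rw [homogeneousComponent_one_mul p (X i) (constantCoeff_X K i), hX, D.leibniz, D.map_smul,
      map_smul, map_add, smul_eq_mul, smul_eq_mul,
      homogeneousComponent_one_mul p _ (hconst i),
      homogeneousComponent_one_mul _ _ (constantCoeff_derivation_eq_zero D hconst p),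
      constantCoeff_X, zero_smul, add_zero]

end MvPolynomial

/-- Linearization of a squared-zero derivation on a free (polynomial) algebra: if
`D : K[Xₓ : x ∈ σ] → K[Xₓ]` is a `K`-linear derivation with `D ∘ D = 0` such that each
`D(Xₓ)` has vanishing constant term, then the linearized differential
`∂_lin = π₁ ∘ D` (with `π₁` the degree-1 homogeneous component) squares to zero on the
module of homogeneous degree-1 polynomials. -/
theorem linearized_differential_squares_to_zero (K : Type*) [CommRing K] (σ : Type*)
    (D : Derivation K (MvPolynomial σ K) (MvPolynomial σ K))
    (hDD : ∀ p : MvPolynomial σ K, D (D p) = 0)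
    (hconst : ∀ x : σ, constantCoeff (D (X x)) = 0) :
    ∀ p ∈ homogeneousSubmodule σ K 1,
      homogeneousComponent 1 (D (homogeneousComponent 1 (D p))) = 0 := by
  intro p _
  rw [homogeneousComponent_one_derivation D hconst, hDD, map_zero]
end

section
/- Let r and k be positive integers, let A_1,…,A_k be real numbers with A_i ≥ 1 for all i, and let CZ_1,…,CZ_k be integers with CZ_i ≤ 1 + 4·A_i for all i. If (2−3)(2−k) + Σ_{i=1}^k CZ_i − 2r = 0, then Σ_{i=1}^k A_i ≥ (r+1)/3. If moreover Σ_{i=1}^k A_i is an integer, then Σ_{i=1}^k A_i ≥ ⌈(r+1)/3⌉. -/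
/-- The action–index estimate underlying `r⟪p₁,…,p_r⟫(B⁴) ≥ ⌈(r+1)/3⌉`: if a rigid curve
with `k` positive ends of actions `A i ≥ 1` and Conley–Zehnder indices `CZ i ≤ 1 + 4 A i`
satisfies the index-zero relation `(2-3)(2-k) + Σ CZ i - 2r = 0`, then the total action is
at least `(r+1)/3`, and at least `⌈(r+1)/3⌉` if it is an integer. -/
theorem ball_action_index_bound (r k : ℕ) (hr : 0 < r) (hk : 0 < k)
    (A : Fin k → ℝ) (hA : ∀ i, 1 ≤ A i)
    (CZ : Fin k → ℤ) (hCZ : ∀ i, (CZ i : ℝ) ≤ 1 + 4 * A i)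
    (hind : ((2 : ℤ) - 3) * (2 - (k : ℤ)) + (∑ i, CZ i) - 2 * (r : ℤ) = 0) :
    ((r : ℝ) + 1) / 3 ≤ ∑ i, A i ∧
      ((∃ N : ℤ, ∑ i, A i = (N : ℝ)) →
        ((⌈((r : ℝ) + 1) / 3⌉ : ℤ) : ℝ) ≤ ∑ i, A i) := by
  have hk_le : (k : ℝ) ≤ ∑ i, A i := by
    simpa using Finset.sum_le_sum fun i (_ : i ∈ Finset.univ) => hA i
  have hCZ_le : (∑ i, (CZ i : ℝ)) ≤ k + 4 * ∑ i, A i := by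
    simpa [Finset.sum_add_distrib, ← Finset.mul_sum] using
      Finset.sum_le_sum fun i (_ : i ∈ Finset.univ) => hCZ i
  have hindex : ((2 : ℝ) - 3) * (2 - k) + (∑ i, (CZ i : ℝ)) - 2 * r = 0 := by
    exact_mod_cast hind
  have hbound : ((r : ℝ) + 1) / 3 ≤ ∑ i, A i := by linarith
  refine ⟨hbound, ?_⟩
  rintro ⟨N, hN⟩
  rw [hN] at hbound ⊢
  exact_mod_cast Int.ceil_le.mpr hbound
end

section
/- Let m, s, k be positive integers and let s_1,…,s_k be positive integers with s + k + Σ_{i=1}^k s_i = m. Then for every real number x ≥ 1, s·x + Σ_{i=1}^k s_i ≥ x + ⌈(m−1)/2⌉. -/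
/-- The action–index estimate in the computation of `g⟪𝒯^{m−1}p⟫(P(1,x))`: if positive
integers satisfy `s + k + Σ tᵢ = m`, then for every real `x ≥ 1` one has
`s·x + Σ tᵢ ≥ x + ⌈(m−1)/2⌉`. -/
theorem polydisk_action_bound (m s k : ℕ) (hm : 0 < m) (hs : 0 < s) (hk : 0 < k)
    (t : Fin k → ℕ) (ht : ∀ i, 0 < t i) (hsum : s + k + ∑ i, t i = m)
    (x : ℝ) (hx : 1 ≤ x) :
    x + ((⌈((m : ℝ) - 1) / 2⌉ : ℤ) : ℝ) ≤ (s : ℝ) * x + ∑ i, (t i : ℝ) := by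
  have hkT : k ≤ ∑ i, t i := by
    simpa using Finset.sum_le_sum fun i (_ : i ∈ Finset.univ) => Nat.one_le_iff_ne_zero.2 (ht i).ne'
  have hceil : ⌈((m : ℝ) - 1) / 2⌉ ≤ (s : ℤ) - 1 + ((∑ i, t i : ℕ) : ℤ) := by
    have hm' : (m : ℝ) + 1 ≤ 2 * s + 2 * ((∑ i, t i : ℕ) : ℝ) := by
      exact_mod_cast (by omega : m + 1 ≤ 2 * s + 2 * ∑ i, t i)
    rw [Int.ceil_le, Int.cast_add, Int.cast_sub, Int.cast_natCast, Int.cast_natCast, Int.cast_one]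
    linarith
  have hceil' : ((⌈((m : ℝ) - 1) / 2⌉ : ℤ) : ℝ) ≤ (s : ℝ) - 1 + ∑ i, (t i : ℝ) := by
    exact_mod_cast hceil
  have hs' : (1 : ℝ) ≤ s := by exact_mod_cast hs
  nlinarith [mul_nonneg (sub_nonneg.2 hs') (sub_nonneg.2 hx)]
end
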